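/- There exists C > 0 with the following property. Let ε > 0 and let w ∈ C^ω_ε(ℝ/ℤ, ℂ²) satisfy δ ≤ ‖w(z)‖ ≤ 1 throughout {|Im z| < ε}. If w(x) is a complex multiple of a real vector for every x ∈ ℝ, then there exists an analytic map w̃ : ℝ → ℝ², admitting a holomorphic extension to {|Im z| < ε}, such that w̃(x + 1) = ± w̃(x) for all x ∈ ℝ, w(x) is a multiple of w̃(x) for every x ∈ ℝ, and C^{−1} δ^{3/2} ≤ ‖w̃(x)‖ ≤ C δ^{−1/2} for |Im x| < ε. -/

import Mathlib

open Complex Real Filter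

noncomputable section

attribute [local instance] Matrix.normedAddCommGroup Matrix.normedSpace

/-- 2×2 complex matrices (holomorphic extensions of real matrix maps). -/
abbrev M2 : Type := Matrix (Fin 2) (Fin 2) ℂ

/-- The horizontal strip of half-width `ε` around the real axis. -/
def Strip (ε : ℝ) : Set ℂ := {z : ℂ | |z.im| < ε}

/-- Iterates of the cocycle: `cocycleIter α A k z = A(z+(k-1)α) ⋯ A(z)`, with value `1` for `k=0`. -/
def cocycleIter (α : ℝ) (A : ℂ → M2) : ℕ → ℂ → M2
  | 0 => fun _ => 1
  | k + 1 => fun z => A (z + (k : ℂ) * (α : ℂ)) * cocycleIter α A k z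

/-- `A ∈ C^ω_ε(ℝ/ℤ, SL(2,ℝ))`: a 1-periodic holomorphic map on the strip of half-width `ε`,
real-valued on `ℝ`, with determinant 1. -/
def IsSL2Strip (ε : ℝ) (A : ℂ → M2) : Prop :=
  DifferentiableOn ℂ A (Strip ε) ∧ (∀ z : ℂ, A (z + 1) = A z) ∧
  (∀ x : ℝ, ∀ i j, (A (x : ℝ) i j).im = 0) ∧ (∀ z ∈ Strip ε, (A z).det = 1)

/-- `B ∈ C^ω_ε(ℝ/ℤ, PSL(2,ℝ))`: a holomorphic map on the strip of half-width `ε`,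
real-valued on `ℝ`, with determinant 1, which is 1-periodic up to sign. -/
def IsPSL2Strip (ε : ℝ) (B : ℂ → M2) : Prop :=
  DifferentiableOn ℂ B (Strip ε) ∧
  (∃ s : ℂ, (s = 1 ∨ s = -1) ∧ ∀ z : ℂ, B (z + 1) = s • B z) ∧
  (∀ x : ℝ, ∀ i j, (B (x : ℝ) i j).im = 0) ∧ (∀ z ∈ Strip ε, (B z).det = 1)

/-- The rotation matrix `R_θ` (with holomorphic dependence on `θ`). -/
def Rot (θ : ℂ) : M2 :=
  !![Complex.cos (2 * π * θ), -Complex.sin (2 * π * θ);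
     Complex.sin (2 * π * θ), Complex.cos (2 * π * θ)]

theorem isOpen_strip (ε : ℝ) : IsOpen (Strip ε) :=
  isOpen_lt (by fun_prop) continuous_const

theorem convex_strip (ε : ℝ) : Convex ℝ (Strip ε) := by
  have h : Strip ε = Complex.imLm ⁻¹' Set.Ioo (-ε) ε := by
    ext z
    simp [Strip, abs_lt]
  rw [h]
  exact (convex_Ioo (-ε) ε).linear_preimage Complex.imLm

/-- A nonvanishing holomorphic function on a convex open set has a holomorphic square root. -/
theorem exists_differentiableOn_sq_eq {U : Set ℂ} (hU : IsOpen U) (hc : Convex ℝ U)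
    {g : ℂ → ℂ} (hg : DifferentiableOn ℂ g U) (h0 : ∀ z ∈ U, g z ≠ 0) :
    ∃ h : ℂ → ℂ, DifferentiableOn ℂ h U ∧ ∀ z ∈ U, h z ^ 2 = g z := by
  rcases U.eq_empty_or_nonempty with rfl | ⟨a, ha⟩
  · exact ⟨0, by simp, by simp⟩
  obtain ⟨F, hF⟩ := hc.exists_forall_hasDerivWithinAt (𝕜 := ℂ) (f := fun z => deriv g z / g z)
    ((hg.deriv hU).div hg h0)
  have hF' : ∀ z ∈ U, HasDerivAt F (deriv g z / g z) z :=
    fun z hz => (hF z hz).hasDerivAt (hU.mem_nhds hz)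
  have hquot : ∀ z ∈ U, HasDerivAt (fun z => g z * Complex.exp (-F z)) 0 z := by
    intro z hz
    have h1 := (hg.differentiableAt (hU.mem_nhds hz)).hasDerivAt.mul (hF' z hz).neg.cexp
    refine h1.congr_deriv ?_
    have := h0 z hz
    field_simp
    ring
  have hconst : ∀ z ∈ U, g z * Complex.exp (-F z) = g a * Complex.exp (-F a) := fun z hz =>
    hU.is_const_of_deriv_eq_zero hc.isPreconnected
      (fun z hz => (hquot z hz).differentiableAt.differentiableWithinAt)
      (fun z hz => (hquot z hz).deriv) hz ha
  obtain ⟨c, hcsq⟩ := IsAlgClosed.exists_pow_nat_eq (g a * Complex.exp (-F a)) two_pos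
  refine ⟨fun z => c * Complex.exp (F z / 2), fun z hz => ?_, fun z hz => ?_⟩
  · exact (((hF' z hz).differentiableAt.div_const 2).cexp.const_mul c).differentiableWithinAt
  · rw [mul_pow, hcsq, ← hconst z hz, ← Complex.exp_nat_mul, mul_assoc, ← Complex.exp_add]
    push_cast
    rw [mul_div_cancel₀ _ two_ne_zero, neg_add_cancel, Complex.exp_zero, mul_one]

/-- If two holomorphic `ℂ²`-valued maps are everywhere collinear and the second does not vanish,
then the first is a holomorphic multiple of the second. -/
theorem exists_differentiableOn_smul_eq {U : Set ℂ} (hU : IsOpen U) {a b : ℂ → Fin 2 → ℂ}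
    (ha : DifferentiableOn ℂ a U) (hb : DifferentiableOn ℂ b U)
    (hab : ∀ z ∈ U, a z 0 * b z 1 = a z 1 * b z 0) (hb0 : ∀ z ∈ U, b z ≠ 0) :
    ∃ g : ℂ → ℂ, DifferentiableOn ℂ g U ∧ ∀ z ∈ U, a z = g z • b z := by
  have hex : ∀ z ∈ U, ∃ c : ℂ, a z = c • b z := by
    intro z hz
    obtain ⟨i, hi⟩ := Function.ne_iff.mp (hb0 z hz)
    refine ⟨a z i / b z i, ?_⟩
    have := hab z hz
    ext j
    fin_cases i <;> fin_cases j <;> simp at hi ⊢ <;> field_simp <;>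
      first
      | linear_combination this
      | linear_combination -this
  choose! g hg using hex
  refine ⟨g, fun z hz => ?_, hg⟩
  obtain ⟨i, hi⟩ := Function.ne_iff.mp (hb0 z hz)
  have hzU := hU.mem_nhds hz
  have hai := differentiableAt_pi.mp (ha.differentiableAt hzU) i
  have hbi := differentiableAt_pi.mp (hb.differentiableAt hzU) i
  refine ((hai.div hbi hi).congr_of_eventuallyEq ?_).differentiableWithinAt
  filter_upwards [hzU, hbi.continuousAt.eventually_ne hi] with y hy hy0
  rw [Pi.div_apply, eq_div_iff hy0, hg y hy, Pi.smul_apply, smul_eq_mul]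

/-- Identity theorem on a strip: holomorphic functions agreeing on the real axis agree. -/
theorem eqOn_strip_of_eq_ofReal {ε : ℝ} (hε : 0 < ε) {f g : ℂ → ℂ}
    (hf : DifferentiableOn ℂ f (Strip ε)) (hg : DifferentiableOn ℂ g (Strip ε))
    (h : ∀ x : ℝ, f x = g x) : Set.EqOn f g (Strip ε) := by
  refine (hf.analyticOnNhd (isOpen_strip ε)).eqOn_of_preconnected_of_mem_closure
    (hg.analyticOnNhd (isOpen_strip ε)) (convex_strip ε).isPreconnected
    (z₀ := 0) (by simpa [Strip] using hε) ?_
  refine mem_closure_of_tendsto (f := fun n : ℕ => (((1 / ((n : ℝ) + 1) : ℝ)) : ℂ))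
    (b := atTop) ?_ (Eventually.of_forall fun n => ⟨h _, ?_⟩)
  · rw [← Complex.ofReal_zero]
    exact (Complex.continuous_ofReal.tendsto 0).comp
      (tendsto_one_div_add_atTop_nhds_zero_nat (𝕜 := ℝ))
  · have : (0 : ℝ) < 1 / ((n : ℝ) + 1) := by positivity
    simpa only [Set.mem_singleton_iff, Complex.ofReal_eq_zero] using this.ne'

/-- **Lemma (real projective section).** There is `C > 0` such that: if
`w ∈ C^ω_ε(ℝ/ℤ, ℂ²)` satisfies `δ ≤ ‖w(z)‖ ≤ 1` on the strip and `w(x)` is a complex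
multiple of a real vector for every real `x`, then there is an analytic `w̃` on the strip,
real-valued on `ℝ`, with `w̃(z+1) = ± w̃(z)`, `w(x)` a multiple of `w̃(x)` for real `x`, and
`C⁻¹ δ^{3/2} ≤ ‖w̃(z)‖ ≤ C δ^{−1/2}` on the strip. -/
theorem lemma_wreal :
    ∃ C : ℝ, 0 < C ∧ ∀ ε : ℝ, 0 < ε → ∀ δ : ℝ, 0 < δ → ∀ w : ℂ → Fin 2 → ℂ,
      DifferentiableOn ℂ w (Strip ε) → (∀ z : ℂ, w (z + 1) = w z) →
      (∀ z ∈ Strip ε, δ ≤ ‖w z‖ ∧ ‖w z‖ ≤ 1) →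
      (∀ x : ℝ, ∃ c : ℂ, ∃ v : Fin 2 → ℝ, w (x : ℝ) = c • fun i => ((v i : ℂ))) →
      ∃ tw : ℂ → Fin 2 → ℂ, ∃ s : ℂ, (s = 1 ∨ s = -1) ∧
        DifferentiableOn ℂ tw (Strip ε) ∧ (∀ z : ℂ, tw (z + 1) = s • tw z) ∧
        (∀ x : ℝ, ∀ i, (tw (x : ℝ) i).im = 0) ∧
        (∀ x : ℝ, ∃ c : ℂ, w (x : ℝ) = c • tw (x : ℝ)) ∧
        (∀ z ∈ Strip ε, C⁻¹ * δ ^ ((3:ℝ)/2) ≤ ‖tw z‖ ∧ ‖tw z‖ ≤ C * δ ^ (-(1:ℝ)/2)) := by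
  refine ⟨1, one_pos, fun ε hε δ hδ w hw hper hbd hreal => ?_⟩
  have hU := isOpen_strip ε
  have hpc := (convex_strip ε).isPreconnected
  have hconj : ∀ z ∈ Strip ε, star z ∈ Strip ε := fun z hz => by simpa [Strip] using hz
  have hshift : ∀ z, z + 1 ∈ Strip ε ↔ z ∈ Strip ε := fun z => by simp [Strip]
  have hxS : ∀ x : ℝ, (x : ℂ) ∈ Strip ε := fun x => by simpa [Strip] using hε
  have hw0 : ∀ z ∈ Strip ε, w z ≠ 0 := fun z hz =>
    norm_pos_iff.mp (hδ.trans_le (hbd z hz).1)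
  set v : ℂ → Fin 2 → ℂ := fun z => star (w (star z)) with hv
  have hvnorm : ∀ z, ‖v z‖ = ‖w (star z)‖ := fun z => norm_star _
  have hvd : DifferentiableOn ℂ v (Strip ε) := fun z hz =>
    (differentiableAt_star_conj_iff.mpr
      (hw.differentiableAt (hU.mem_nhds (hconj z hz)))).differentiableWithinAt
  have hwi : ∀ i, DifferentiableOn ℂ (fun z => w z i) (Strip ε) := differentiableOn_pi.mp hw
  have hvi : ∀ i, DifferentiableOn ℂ (fun z => v z i) (Strip ε) := differentiableOn_pi.mp hvd
  have hcol : ∀ z ∈ Strip ε, v z 0 * w z 1 = v z 1 * w z 0 := by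
    refine eqOn_strip_of_eq_ofReal hε ((hvi 0).mul (hwi 1)) ((hvi 1).mul (hwi 0)) fun x => ?_
    obtain ⟨c, u, hcu⟩ := hreal x
    simp [hv, hcu]
    ring
  obtain ⟨g, hgd, hg⟩ := exists_differentiableOn_smul_eq hU hvd hw hcol hw0
  have hg0 : ∀ z ∈ Strip ε, g z ≠ 0 := by
    intro z hz h0
    have h1 := hg z hz
    rw [h0, zero_smul] at h1
    exact hw0 _ (hconj z hz) (star_eq_zero.mp h1)
  obtain ⟨h, hhd, hh⟩ := exists_differentiableOn_sq_eq hU (convex_strip ε) hgd hg0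
  have hh0 : ∀ z ∈ Strip ε, h z ≠ 0 := fun z hz h0 => hg0 z hz (by rw [← hh z hz, h0]; simp)
  have hgper : ∀ z ∈ Strip ε, g (z + 1) = g z := by
    intro z hz
    have h1 := hg (z + 1) ((hshift z).mpr hz)
    have h2 : v (z + 1) = v z := by simp [hv, hper]
    rw [h2, hg z hz, hper] at h1
    exact (smul_left_injective ℂ (hw0 z hz) h1).symm
  have hhs : DifferentiableOn ℂ (fun z => h (z + 1)) (Strip ε) :=
    hhd.comp (by fun_prop) fun z hz => (hshift z).mpr hz
  obtain ⟨s, hs, hsh⟩ : ∃ s : ℂ, (s = 1 ∨ s = -1) ∧ ∀ z ∈ Strip ε, h (z + 1) = s * h z := by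
    rcases hpc.eq_or_eq_neg_of_sq_eq hhs.continuousOn hhd.continuousOn
      (fun z hz => by
        simp only [Pi.pow_apply]
        rw [hh z hz, hh _ ((hshift z).mpr hz), hgper z hz]) (fun {z} hz => hh0 z hz) with H | H
    · exact ⟨1, Or.inl rfl, fun z hz => by simpa using H hz⟩
    · exact ⟨-1, Or.inr rfl, fun z hz => by simpa using H hz⟩
  have hsq : ∀ z ∈ Strip ε, ‖h z‖ ^ 2 * ‖w z‖ = ‖w (star z)‖ := fun z hz => by
    rw [← norm_pow, hh z hz, ← norm_smul, ← hg z hz, hvnorm]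
  classical
  refine ⟨fun z => if z ∈ Strip ε then h z • w z else 0, s, hs, ?_, ?_, ?_, ?_, ?_⟩
  · exact (hhd.smul hw).congr fun z hz => if_pos hz
  · intro z
    by_cases hz : z ∈ Strip ε
    · simp only [hz, (hshift z).mpr hz, if_true]
      rw [hsh z hz, hper, mul_smul]
    · simp [hz, hshift]
  · intro x i
    simp only [hxS x, if_true]
    have h1 : star (w x) = h x ^ 2 • w x := by
      rw [hh x (hxS x), ← hg x (hxS x)]
      simp [hv]
    have h2 : ‖h x‖ ^ 2 = 1 := by
      have h3 := hsq x (hxS x)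
      have h4 : star (x : ℂ) = x := Complex.conj_ofReal x
      rw [h4] at h3
      exact mul_right_cancel₀ (norm_ne_zero_iff.mpr (hw0 x (hxS x))) (by rw [h3, one_mul])
    have h5 : star (h x) * h x = 1 := by
      have := Complex.conj_mul' (h x)
      rw [← Complex.ofReal_pow, h2, Complex.ofReal_one] at this
      exact this
    have h6 := congrFun h1 i
    simp only [Pi.star_apply, Pi.smul_apply, smul_eq_mul] at h6 ⊢
    refine Complex.conj_eq_iff_im.mp ?_
    change star (h x * w x i) = h x * w x i
    rw [star_mul', h6]
    linear_combination (h x * w x i) * h5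
  · intro x
    refine ⟨(h x)⁻¹, ?_⟩
    simp only [hxS x, if_true]
    rw [inv_smul_smul₀ (hh0 x (hxS x))]
  · intro z hz
    simp only [hz, if_true]
    rw [norm_smul, inv_one, one_mul, one_mul]
    obtain ⟨hl, hu⟩ := hbd z hz
    obtain ⟨hl', hu'⟩ := hbd _ (hconj z hz)
    have h1 := hsq z hz
    have hn := norm_nonneg (h z)
    have hlow : δ ^ ((1 : ℝ) / 2) ≤ ‖h z‖ := by
      rw [← Real.sqrt_eq_rpow]
      refine Real.sqrt_le_left hn |>.mpr ?_
      nlinarith [sq_nonneg ‖h z‖]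
    have hupp : ‖h z‖ ≤ δ ^ (-(1 : ℝ) / 2) := by
      rw [neg_div, Real.rpow_neg hδ.le, ← Real.sqrt_eq_rpow, ← Real.sqrt_inv]
      refine Real.le_sqrt_of_sq_le ?_
      rw [← one_div, le_div_iff₀ hδ]
      nlinarith [sq_nonneg ‖h z‖]
    constructor
    · have h3 : δ ^ ((3 : ℝ) / 2) = δ ^ ((1 : ℝ) / 2) * δ := by
        rw [← Real.rpow_add_one hδ.ne']
        norm_num
      rw [h3]
      gcongr
    · exact (mul_le_of_le_one_right hn hu).trans hupp
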